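/- arXiv:2510.08248 — 3 statements merged into one kernel-verified Lean document; each statement's English description precedes it below -/
import Mathlib

section
/- Let d ≥ 2. There exist a finite set Λ ⊆ S^{d−1} ∩ ℚ^d and, for each ξ ∈ Λ, a nonnegative C^∞ function Γ_ξ : S^{d−1} → ℝ, such that for every R ∈ S^{d−1} one has R = Σ_{ξ∈Λ} Γ_ξ(R) ξ. -/
open MeasureTheory Real Set Metric
open scoped ENNReal Manifold

noncomputable section

/-- `ℝ^d` with the Euclidean structure. -/
abbrev Rd (d : ℕ) := EuclideanSpace ℝ (Fin d)

/-- The coefficients `(1 + ⟪ξ, x⟫) / 2` over `ξ ∈ {±e₁, …, ±e_d}` reproduce `x`. -/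
theorem sum_signed_basis_smul {ι : Type*} [Fintype ι] [DecidableEq ι] (x : EuclideanSpace ℝ ι) :
    ∑ ξ ∈ Finset.univ.image (fun i : ι => EuclideanSpace.single i (1 : ℝ)) ∪
        Finset.univ.image (fun i : ι => -EuclideanSpace.single i (1 : ℝ)),
      ((1 + inner ℝ ξ x) / 2) • ξ = x := by
  have hinj : Function.Injective (fun i : ι => EuclideanSpace.single i (1 : ℝ)) := by
    intro i j hij
    by_contra hne
    simpa [hne] using congrArg (fun v : EuclideanSpace ℝ ι => v i) hij
  rw [Finset.sum_union, Finset.sum_image hinj.injOn,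
    Finset.sum_image fun i _ j _ hij => hinj (neg_injective hij), ← Finset.sum_add_distrib]
  · ext k
    simp only [inner_neg_left, EuclideanSpace.inner_single_left, map_one, one_mul]
    simp [Pi.single_apply, Finset.sum_add_distrib]
    ring
  · rw [Finset.disjoint_left]
    intro v hv hv'
    obtain ⟨i, -, rfl⟩ := Finset.mem_image.1 hv
    obtain ⟨j, -, hj⟩ := Finset.mem_image.1 hv'
    have h := congrArg (fun v : EuclideanSpace ℝ ι => v i) hj
    by_cases hij : i = j
    · norm_num [hij] at h
    · simp [hij] at h

/-- **geometric lemma.** For `d ≥ 2` there exist a finite set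
`Λ ⊆ S^{d-1} ∩ ℚ^d` and, for each `ξ ∈ Λ`, a nonnegative `C^∞` function
`Γ_ξ : S^{d-1} → ℝ` such that every `R ∈ S^{d-1}` satisfies `R = Σ_{ξ∈Λ} Γ_ξ(R) ξ`. -/
theorem stmt_3 (d : ℕ) (hd : 2 ≤ d) :
    letI : Fact (Module.finrank ℝ (Rd d) = d - 1 + 1) :=
      ⟨by simp only [finrank_euclideanSpace_fin]; omega⟩
    ∃ (Λ : Finset (Rd d))
      (Γ : Rd d → (Metric.sphere (0 : Rd d) 1) → ℝ),
      (∀ ξ ∈ Λ, ‖ξ‖ = 1 ∧ ∀ i : Fin d, ∃ q : ℚ, ξ i = (q : ℝ)) ∧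
      (∀ ξ ∈ Λ, (∀ R, 0 ≤ Γ ξ R) ∧ ContMDiff (𝓡 (d - 1)) 𝓘(ℝ) (⊤ : ℕ∞) (Γ ξ)) ∧
      (∀ R : Metric.sphere (0 : Rd d) 1,
        (R : Rd d) = ∑ ξ ∈ Λ, Γ ξ R • ξ) := by
  classical
  have : Fact (Module.finrank ℝ (Rd d) = d - 1 + 1) :=
    ⟨by simp only [finrank_euclideanSpace_fin]; omega⟩
  have hΛ : ∀ ξ ∈ Finset.univ.image (fun i : Fin d => EuclideanSpace.single i (1 : ℝ)) ∪
      Finset.univ.image (fun i : Fin d => -EuclideanSpace.single i (1 : ℝ)),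
      ‖ξ‖ = 1 ∧ ∀ i : Fin d, ∃ q : ℚ, ξ i = (q : ℝ) := by
    intro ξ hξ
    simp only [Finset.mem_union, Finset.mem_image, Finset.mem_univ, true_and] at hξ
    rcases hξ with ⟨j, rfl⟩ | ⟨j, rfl⟩
    · exact ⟨by simp, fun i => ⟨if i = j then 1 else 0, by split_ifs with h <;> simp [h]⟩⟩
    · exact ⟨by simp, fun i => ⟨-if i = j then 1 else 0, by split_ifs with h <;> simp [h]⟩⟩
  refine ⟨_, fun ξ R => (1 + inner ℝ ξ (R : Rd d)) / 2, hΛ, fun ξ hξ => ⟨fun R => ?_, ?_⟩,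
    fun R => (sum_signed_basis_smul (R : Rd d)).symm⟩
  · have h := abs_real_inner_le_norm ξ (R : Rd d)
    rw [(hΛ ξ hξ).1, norm_eq_of_mem_sphere, one_mul] at h
    linarith [(abs_le.1 h).1]
  · have h : ContDiff ℝ (⊤ : ℕ∞) (fun x : Rd d => (1 + inner ℝ ξ x) / 2) :=
      (contDiff_const.add (contDiff_const.inner ℝ contDiff_id)).div_const 2
    exact h.contMDiff.comp contMDiff_coe_sphere

end
end

section
/- Let d ≥ 2 and p ∈ [1,∞). There exists a constant C = C(d,p) such that for every smooth ℤ^d-periodic function f : ℝ^d → ℝ, every smooth function a : ℝ^d → ℝ with support contained in Q = [−1/2,1/2]^d, and every integer σ ≥ 1, one has | ‖a · f(σ·)‖_{L^p(Q)} − ‖a‖_{L^p(Q)} · ‖f‖_{L^p(Q)} | ≤ C σ^{−1/p} ‖a‖_{C¹} ‖f‖_{L^p(Q)}, where f(σ·) denotes the function x ↦ f(σx). -/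
open MeasureTheory Real Set
open scoped ENNReal

noncomputable section

/-- The closed unit cube `Q = [-1/2, 1/2]^d`. -/
def unitCube (d : ℕ) : Set (Rd d) := {x | ∀ i, |x i| ≤ 1 / 2}

/-- `g` is `ℤ^d`-periodic. -/
def ZdPeriodic {d : ℕ} (g : Rd d → ℝ) : Prop :=
  ∀ (k : Fin d → ℤ) (x : Rd d),
    g (x + (EuclideanSpace.equiv (Fin d) ℝ).symm (fun i => (k i : ℝ))) = g x

/-- The `L^p` norm on the unit cube `Q`, for a real exponent `p ∈ [1,∞)`. -/
noncomputable def LpQ (d : ℕ) (p : ℝ) (g : Rd d → ℝ) : ℝ :=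
  (∫ x in unitCube d, |g x| ^ p) ^ (1 / p)

/-- The `C¹` norm `sup |a| + sup |∇a|`. -/
noncomputable def C1Norm {d : ℕ} (a : Rd d → ℝ) : ℝ :=
  (⨆ x, |a x|) + ⨆ x, ‖fderiv ℝ a x‖

/-- The half-open cube `[-1/2, 1/2)^d`. -/
def halfOpenCube (d : ℕ) : Set (Rd d) := {x | ∀ i, x i ∈ Set.Ico (-1 / 2 : ℝ) (1 / 2)}

theorem unitCube_eq_preimage (d : ℕ) :
    unitCube d = WithLp.ofLp ⁻¹' Set.Icc (fun _ : Fin d => (-1 / 2 : ℝ)) (fun _ => 1 / 2) := by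
  ext x
  simp only [unitCube, mem_ofPred_eq, mem_preimage, mem_Icc, Pi.le_def, abs_le, ← forall_and]
  norm_num [neg_div]

theorem halfOpenCube_eq_preimage (d : ℕ) :
    halfOpenCube d =
      WithLp.ofLp ⁻¹' Set.pi univ (fun _ : Fin d => Set.Ico (-1 / 2 : ℝ) (1 / 2)) := by
  ext x
  simp [halfOpenCube, mem_pi]

theorem isClosed_unitCube (d : ℕ) : IsClosed (unitCube d) := by
  rw [unitCube_eq_preimage]
  exact isClosed_Icc.preimage (PiLp.continuous_ofLp 2 _)

theorem norm_le_of_mem_unitCube {d : ℕ} {x : Rd d} (hx : x ∈ unitCube d) : ‖x‖ ≤ √d := by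
  rw [EuclideanSpace.norm_eq]
  apply Real.sqrt_le_sqrt
  calc ∑ i, ‖x i‖ ^ 2 ≤ ∑ _i : Fin d, (1 : ℝ) := by
        refine Finset.sum_le_sum fun i _ => ?_
        have h := hx i
        rw [Real.norm_eq_abs]
        nlinarith [abs_nonneg (x i)]
    _ = d := by simp

theorem isCompact_unitCube (d : ℕ) : IsCompact (unitCube d) :=
  (isCompact_closedBall (0 : Rd d) (√d)).of_isClosed_subset (isClosed_unitCube d)
    fun x hx => by simpa using norm_le_of_mem_unitCube hx

theorem halfOpenCube_ae_eq_unitCube (d : ℕ) :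
    halfOpenCube d =ᵐ[volume] unitCube d := by
  rw [halfOpenCube_eq_preimage, unitCube_eq_preimage]
  exact (PiLp.volume_preserving_ofLp (Fin d)).quasiMeasurePreserving.preimage_ae_eq
    Measure.univ_pi_Ico_ae_eq_Icc

theorem volume_unitCube (d : ℕ) : volume (unitCube d) = 1 := by
  rw [unitCube_eq_preimage, (PiLp.volume_preserving_ofLp (Fin d)).measure_preimage
    measurableSet_Icc.nullMeasurableSet, Real.volume_Icc_pi]
  norm_num

open scoped Pointwise in
theorem isAddFundamentalDomain_halfOpenCube (d : ℕ) :
    IsAddFundamentalDomain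
      (Submodule.span ℤ (Set.range (EuclideanSpace.basisFun (Fin d) ℝ).toBasis)).toAddSubgroup
      (halfOpenCube d) volume := by
  have heq : halfOpenCube d = (WithLp.toLp 2 (fun _ => (-1 / 2 : ℝ)) : Rd d) +ᵥ
      ZSpan.fundamentalDomain (EuclideanSpace.basisFun (Fin d) ℝ).toBasis := by
    ext x
    rw [mem_vadd_set_iff_neg_vadd_mem, ZSpan.mem_fundamentalDomain]
    refine forall_congr' fun i => ?_
    simp only [OrthonormalBasis.coe_toBasis_repr_apply, EuclideanSpace.basisFun_repr,
      PiLp.add_apply, PiLp.neg_apply, vadd_eq_add, mem_Ico]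
    constructor <;> rintro ⟨h1, h2⟩ <;> constructor <;> linarith
  rw [heq]
  exact (ZSpan.isAddFundamentalDomain' (EuclideanSpace.basisFun (Fin d) ℝ).toBasis
    volume).vadd_of_comm _

open scoped Pointwise in
theorem setLIntegral_unitCube_add {d : ℕ} {u : Rd d → ℝ≥0∞}
    (hu : ∀ (k : Fin d → ℤ) (x : Rd d),
      u (x + (EuclideanSpace.equiv (Fin d) ℝ).symm (fun i => (k i : ℝ))) = u x) (z : Rd d) :
    ∫⁻ y in unitCube d, u (z + y) = ∫⁻ y in unitCube d, u y := by
  have hdom := isAddFundamentalDomain_halfOpenCube d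
  have : Countable
      (Submodule.span ℤ (Set.range (EuclideanSpace.basisFun (Fin d) ℝ).toBasis)).toAddSubgroup :=
    inferInstanceAs <| Countable
      (Submodule.span ℤ (Set.range (EuclideanSpace.basisFun (Fin d) ℝ).toBasis))
  have hmp := measurePreserving_add_left (volume : Measure (Rd d)) z
  rw [← setLIntegral_congr (halfOpenCube_ae_eq_unitCube d),
    ← setLIntegral_congr (halfOpenCube_ae_eq_unitCube d)]
  have hpre : halfOpenCube d = (fun y => z + y) ⁻¹' (z +ᵥ halfOpenCube d) := by
    ext y
    simp [mem_vadd_set_iff_neg_vadd_mem]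
  conv_lhs => rw [hpre]
  rw [hmp.setLIntegral_comp_preimage_emb (measurableEmbedding_addLeft z)]
  refine (hdom.vadd_of_comm z).setLIntegral_eq hdom u ?_
  rintro ⟨g, hg⟩ x
  obtain ⟨c, rfl⟩ := (Submodule.mem_span_range_iff_exists_fun ℤ).1 hg
  rw [← hu c x]
  congr 1
  rw [AddSubgroup.vadd_def, vadd_eq_add, add_comm]
  congr 1
  ext i
  simp [Finset.sum_apply, Pi.single_apply]

theorem lintegral_unitCube_lintegral_translate_mul {d : ℕ} {h u : Rd d → ℝ≥0∞}
    (hh : Measurable h) (hum : Measurable u)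
    (hu : ∀ (k : Fin d → ℤ) (x : Rd d),
      u (x + (EuclideanSpace.equiv (Fin d) ℝ).symm (fun i => (k i : ℝ))) = u x)
    {s : ℝ} (hs : s ≠ 0) :
    ∫⁻ z, h (z.1 - s⁻¹ • z.2) * u (s • z.1)
        ∂(volume : Measure (Rd d)).prod (volume.restrict (unitCube d)) =
      (∫⁻ x, h x) * ∫⁻ y in unitCube d, u y := by
  rw [lintegral_prod_symm' _ (by fun_prop)]
  calc ∫⁻ y in unitCube d, ∫⁻ x, h (x - s⁻¹ • y) * u (s • x)
      = ∫⁻ y in unitCube d, ∫⁻ x, h x * u (s • x + y) := by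
        refine lintegral_congr fun y => ?_
        rw [← lintegral_add_right_eq_self _ (s⁻¹ • y)]
        simp [smul_smul, hs]
    _ = ∫⁻ x, ∫⁻ y in unitCube d, h x * u (s • x + y) :=
        lintegral_lintegral_swap (by fun_prop)
    _ = ∫⁻ x, h x * ∫⁻ y in unitCube d, u y := by
        refine lintegral_congr fun x => ?_
        rw [lintegral_const_mul _ (by fun_prop), setLIntegral_unitCube_add hu]
    _ = _ := lintegral_mul_const _ hh

theorem ofReal_abs_rpow {p : ℝ} (hp : 0 ≤ p) (t : ℝ) :
    ENNReal.ofReal (|t| ^ p) = ‖t‖ₑ ^ p := by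
  rw [← ENNReal.ofReal_rpow_of_nonneg (abs_nonneg _) hp, ← Real.norm_eq_abs, ofReal_norm]

theorem LpQ_eq_toReal {d : ℕ} {p : ℝ} (hp : 0 ≤ p) {g : Rd d → ℝ} (hg : Measurable g) :
    LpQ d p g = ((∫⁻ x in unitCube d, ‖g x‖ₑ ^ p) ^ (1 / p)).toReal := by
  have hm : Measurable fun x => |g x| ^ p := by
    simp_rw [← Real.norm_eq_abs]
    exact hg.norm.pow_const p
  rw [LpQ, integral_eq_lintegral_of_nonneg_ae (.of_forall fun x => by positivity)
    hm.aestronglyMeasurable, ← ENNReal.toReal_rpow]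
  simp_rw [ofReal_abs_rpow hp]

theorem setLIntegral_unitCube_lt_top {d : ℕ} {p : ℝ} (hp : 0 ≤ p) {g : Rd d → ℝ}
    (hg : Continuous g) : ∫⁻ x in unitCube d, ‖g x‖ₑ ^ p < ∞ := by
  have hc : Continuous fun x => |g x| ^ p :=
    hg.abs.rpow_const fun x => Or.inr hp
  have := (hc.continuousOn.integrableOn_compact (μ := volume) (isCompact_unitCube d)).2
  refine lt_of_eq_of_lt (lintegral_congr fun x => ?_) this
  rw [← ofReal_abs_rpow hp, Real.enorm_eq_ofReal (Real.rpow_nonneg (abs_nonneg _) _)]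

theorem hasCompactSupport_of_support_subset_unitCube {d : ℕ} {a : Rd d → ℝ}
    (ha : Function.support a ⊆ unitCube d) : HasCompactSupport a :=
  .of_support_subset_isCompact (isCompact_unitCube d) ha

theorem norm_fderiv_le_C1Norm {d : ℕ} {a : Rd d → ℝ} (ha : ContDiff ℝ 1 a)
    (hs : HasCompactSupport a) (x : Rd d) : ‖fderiv ℝ a x‖ ≤ C1Norm a := by
  obtain ⟨M, hM⟩ := (ha.continuous_fderiv one_ne_zero).bounded_above_of_compact_support
    (hs.fderiv ℝ)
  have h := le_ciSup (f := fun x => ‖fderiv ℝ a x‖) ⟨M, by rintro _ ⟨y, rfl⟩; exact hM y⟩ x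
  have h0 : 0 ≤ ⨆ x, |a x| := Real.iSup_nonneg fun x => abs_nonneg _
  simp only [C1Norm]
  linarith

theorem C1Norm_nonneg {d : ℕ} (a : Rd d → ℝ) : 0 ≤ C1Norm a :=
  add_nonneg (Real.iSup_nonneg fun _ => abs_nonneg _) (Real.iSup_nonneg fun _ => norm_nonneg _)

theorem abs_sub_le_C1Norm_mul {d : ℕ} {a : Rd d → ℝ} (ha : ContDiff ℝ 1 a)
    (hs : HasCompactSupport a) (x y : Rd d) : |a y - a x| ≤ C1Norm a * ‖y - x‖ :=
  convex_univ.norm_image_sub_le_of_norm_fderiv_le (𝕜 := ℝ)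
    (fun z _ => (ha.differentiable one_ne_zero) z)
    (fun z _ => norm_fderiv_le_C1Norm ha hs z) (mem_univ _) (mem_univ _)

/-- Shifting `a` by `s⁻¹ • y` with `y` in the unit cube changes it by `O(1 / s)`, and only near the
unit cube. -/
theorem enorm_translate_sub_le {d : ℕ} {a : Rd d → ℝ} (ha : ContDiff ℝ 1 a)
    (hs : Function.support a ⊆ unitCube d) {s : ℝ} (hs1 : 1 ≤ s) {x y : Rd d}
    (hy : y ∈ unitCube d) :
    ‖a (x - s⁻¹ • y) - a x‖ₑ ≤
      ENNReal.ofReal (C1Norm a * (√d * s⁻¹)) *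
        (Metric.closedBall (0 : Rd d) (2 * √d)).indicator 1 (x - s⁻¹ • y) := by
  have hy' : ‖s⁻¹ • y‖ ≤ √d * s⁻¹ := by
    rw [norm_smul, Real.norm_of_nonneg (by positivity), mul_comm]
    gcongr
    exact norm_le_of_mem_unitCube hy
  have hy'' : ‖s⁻¹ • y‖ ≤ √d :=
    hy'.trans (mul_le_of_le_one_right (by positivity) (inv_le_one_of_one_le₀ hs1))
  by_cases hx : x - s⁻¹ • y ∈ Metric.closedBall (0 : Rd d) (2 * √d)
  · rw [indicator_of_mem hx, Pi.one_apply, mul_one, ← ofReal_norm]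
    refine ENNReal.ofReal_le_ofReal ?_
    refine (abs_sub_le_C1Norm_mul ha (hasCompactSupport_of_support_subset_unitCube hs) _ _).trans ?_
    have h0 := C1Norm_nonneg a
    rw [sub_sub_cancel_left, norm_neg]
    gcongr
  · have h1 : a (x - s⁻¹ • y) = 0 := by
      by_contra h
      have := norm_le_of_mem_unitCube (hs h)
      rw [mem_closedBall_zero_iff] at hx
      linarith [Real.sqrt_nonneg d]
    have h2 : a x = 0 := by
      by_contra h
      have := norm_le_of_mem_unitCube (hs h)
      rw [mem_closedBall_zero_iff] at hx
      linarith [norm_sub_le x (s⁻¹ • y)]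
    simp [h1, h2]

theorem abs_toReal_sub_toReal_le {A B D : ℝ≥0∞} (hA : A ≠ ∞) (hB : B ≠ ∞) (hD : D ≠ ∞)
    (hAB : A ≤ B + D) (hBA : B ≤ A + D) : |A.toReal - B.toReal| ≤ D.toReal := by
  have h1 := ENNReal.toReal_mono (by finiteness) hAB
  have h2 := ENNReal.toReal_mono (by finiteness) hBA
  rw [ENNReal.toReal_add (by assumption) hD] at h1 h2
  rw [abs_le]
  constructor <;> linarith

/-- The Hölder-type estimate, with the better rate `1 / s`. -/
theorem abs_LpQ_mul_sub_le {d : ℕ} {p : ℝ} (hp : 1 ≤ p) {f a : Rd d → ℝ} (hf : Continuous f)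
    (hper : ZdPeriodic f) (ha : ContDiff ℝ 1 a) (hsupp : Function.support a ⊆ unitCube d)
    {s : ℝ} (hs : 1 ≤ s) :
    |LpQ d p (fun x => a x * f (s • x)) - LpQ d p a * LpQ d p f| ≤
      √d * (volume (Metric.closedBall (0 : Rd d) (2 * √d)) ^ (1 / p)).toReal * s⁻¹ *
        C1Norm a * LpQ d p f := by
  have hp0 : 0 < p := by linarith
  have hs0 : s ≠ 0 := by positivity
  have hac : Continuous a := ha.continuous
  have hafc : Continuous fun x => a x * f (s • x) := by fun_prop
  have hum : Measurable fun x => ‖f x‖ₑ ^ p := by fun_prop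
  have hu : ∀ (k : Fin d → ℤ) (x : Rd d),
      ‖f (x + (EuclideanSpace.equiv (Fin d) ℝ).symm (fun i => (k i : ℝ)))‖ₑ ^ p = ‖f x‖ₑ ^ p :=
    fun k x => by rw [hper k x]
  set μ := (volume : Measure (Rd d)).prod (volume.restrict (unitCube d)) with hμ
  set q := ENNReal.ofReal p
  have hqp : q.toReal = p := ENNReal.toReal_ofReal hp0.le
  have hq1 : 1 ≤ q := ENNReal.one_le_ofReal.2 hp
  have hnorm (F : Rd d × Rd d → ℝ) : eLpNorm F q μ = (∫⁻ z, ‖F z‖ₑ ^ p ∂μ) ^ (1 / p) := by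
    rw [eLpNorm_eq_lintegral_rpow_enorm_toReal (by positivity) ENNReal.ofReal_ne_top, hqp]
  set F₀ : Rd d × Rd d → ℝ := fun z => a z.1 * f (s • z.1) with hF₀
  set F₁ : Rd d × Rd d → ℝ := fun z => a (z.1 - s⁻¹ • z.2) * f (s • z.1) with hF₁
  have hF₀c : Continuous F₀ := by fun_prop
  have hF₁c : Continuous F₁ := by fun_prop
  have hsub : ∫⁻ x, ‖a x‖ₑ ^ p = ∫⁻ x in unitCube d, ‖a x‖ₑ ^ p := by
    refine (setLIntegral_eq_of_support_subset fun x hx => hsupp fun h => hx ?_).symm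
    simp [h, hp0]
  have hsub' : ∫⁻ x, ‖a x * f (s • x)‖ₑ ^ p = ∫⁻ x in unitCube d, ‖a x * f (s • x)‖ₑ ^ p := by
    refine (setLIntegral_eq_of_support_subset fun x hx => hsupp fun h => hx ?_).symm
    simp [h, hp0]
  have hN₀ : eLpNorm F₀ q μ = (∫⁻ x in unitCube d, ‖a x * f (s • x)‖ₑ ^ p) ^ (1 / p) := by
    rw [hnorm, hμ, lintegral_prod _ (by fun_prop), ← hsub']
    simp [hF₀, volume_unitCube]
  have hN₁ : eLpNorm F₁ q μ = (∫⁻ x in unitCube d, ‖a x‖ₑ ^ p) ^ (1 / p) *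
      (∫⁻ x in unitCube d, ‖f x‖ₑ ^ p) ^ (1 / p) := by
    rw [hnorm, ← ENNReal.mul_rpow_of_nonneg _ _ (by positivity), ← hsub,
      ← lintegral_unitCube_lintegral_translate_mul (by fun_prop) hum hu hs0]
    simp only [hF₁, enorm_mul, ENNReal.mul_rpow_of_nonneg _ _ hp0.le, hμ]
  have hD : eLpNorm (F₁ - F₀) q μ ≤ ENNReal.ofReal (C1Norm a * (√d * s⁻¹)) *
      (volume (Metric.closedBall (0 : Rd d) (2 * √d)) ^ (1 / p) *
        (∫⁻ x in unitCube d, ‖f x‖ₑ ^ p) ^ (1 / p)) := by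
    have hB : MeasurableSet (Metric.closedBall (0 : Rd d) (2 * √d)) :=
      Metric.isClosed_closedBall.measurableSet
    rw [hnorm, ← ENNReal.mul_rpow_of_nonneg _ _ (by positivity), ← lintegral_indicator_one hB,
      ← lintegral_unitCube_lintegral_translate_mul (measurable_one.indicator hB) hum hu hs0,
      ← ENNReal.rpow_rpow_inv hp0.ne' (ENNReal.ofReal _), ← one_div p,
      ← ENNReal.mul_rpow_of_nonneg _ _ (by positivity)]
    gcongr
    rw [← lintegral_const_mul' _ _ (by finiteness)]
    refine lintegral_mono_ae ?_
    have hmem : ∀ᵐ z ∂μ, z.2 ∈ unitCube d :=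
      Measure.quasiMeasurePreserving_snd.ae
        (ae_restrict_mem (isClosed_unitCube d).measurableSet)
    filter_upwards [hmem] with z hz
    have h := enorm_translate_sub_le ha hsupp hs (x := z.1) hz
    simp only [Pi.sub_apply, hF₀, hF₁]
    rw [← sub_mul, enorm_mul, ENNReal.mul_rpow_of_nonneg _ _ hp0.le, ← mul_assoc]
    gcongr
    refine (ENNReal.rpow_le_rpow h hp0.le).trans_eq ?_
    rw [ENNReal.mul_rpow_of_nonneg _ _ hp0.le]
    congr 1
    by_cases hx : z.1 - s⁻¹ • z.2 ∈ Metric.closedBall (0 : Rd d) (2 * √d) <;> simp [hx, hp0]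
  have hfin {g : Rd d → ℝ} (hg : Continuous g) :
      (∫⁻ x in unitCube d, ‖g x‖ₑ ^ p) ^ (1 / p) ≠ ∞ :=
    ENNReal.rpow_ne_top_of_nonneg (by positivity) (setLIntegral_unitCube_lt_top hp0.le hg).ne
  have hBfin : volume (Metric.closedBall (0 : Rd d) (2 * √d)) ^ (1 / p) ≠ ∞ :=
    ENNReal.rpow_ne_top_of_nonneg (by positivity) measure_closedBall_lt_top.ne
  rw [LpQ_eq_toReal hp0.le hafc.measurable, LpQ_eq_toReal hp0.le hac.measurable,
    LpQ_eq_toReal hp0.le hf.measurable, ← ENNReal.toReal_mul, ← hN₀, ← hN₁]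
  refine (abs_toReal_sub_toReal_le (D := eLpNorm (F₁ - F₀) q μ) ?_ ?_ ?_ ?_ ?_).trans
    ((ENNReal.toReal_mono ?_ hD).trans_eq ?_)
  · exact hN₀ ▸ hfin hafc
  · exact hN₁ ▸ ENNReal.mul_ne_top (hfin hac) (hfin hf)
  · exact ne_top_of_le_ne_top (ENNReal.mul_ne_top ENNReal.ofReal_ne_top
      (ENNReal.mul_ne_top hBfin (hfin hf))) hD
  · have := eLpNorm_sub_le (p := q) (μ := μ) hF₁c.aestronglyMeasurable
      (hF₁c.sub hF₀c).aestronglyMeasurable hq1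
    simpa using this
  · have := eLpNorm_add_le (p := q) (μ := μ) hF₀c.aestronglyMeasurable
      (hF₁c.sub hF₀c).aestronglyMeasurable hq1
    simpa using this
  · exact ENNReal.mul_ne_top ENNReal.ofReal_ne_top (ENNReal.mul_ne_top hBfin (hfin hf))
  · have h0 := C1Norm_nonneg a
    rw [ENNReal.toReal_mul, ENNReal.toReal_mul, ENNReal.toReal_ofReal (by positivity)]
    ring

/-- **improved Hölder inequality.** For `d ≥ 2` and `p ∈ [1,∞)` there is a
constant `C = C(d,p)` such that for every smooth `ℤ^d`-periodic `f : ℝ^d → ℝ`, every smooth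
`a : ℝ^d → ℝ` supported in `Q = [-1/2,1/2]^d` and every integer `σ ≥ 1`,
`| ‖a·f(σ·)‖_{L^p(Q)} − ‖a‖_{L^p(Q)}·‖f‖_{L^p(Q)} | ≤ C σ^{-1/p} ‖a‖_{C¹} ‖f‖_{L^p(Q)}`. -/
theorem stmt_4 (d : ℕ) (hd : 2 ≤ d) (p : ℝ) (hp : 1 ≤ p) :
    ∃ C : ℝ, 0 < C ∧
      ∀ f a : Rd d → ℝ, ContDiff ℝ (⊤ : ℕ∞) f → ZdPeriodic f →
        ContDiff ℝ (⊤ : ℕ∞) a → Function.support a ⊆ unitCube d →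
        ∀ σ : ℕ, 1 ≤ σ →
          |LpQ d p (fun x => a x * f ((σ : ℝ) • x)) - LpQ d p a * LpQ d p f| ≤
            C * (σ : ℝ) ^ (-1 / p) * C1Norm a * LpQ d p f := by
  set K := √d * (volume (Metric.closedBall (0 : Rd d) (2 * √d)) ^ (1 / p)).toReal with hK
  have hK0 : 0 ≤ K := by positivity
  refine ⟨K + 1, by positivity, fun f a hf hper ha hsupp σ hσ => ?_⟩
  have hσ' : (1 : ℝ) ≤ σ := by exact_mod_cast hσ
  refine (abs_LpQ_mul_sub_le hp hf.continuous hper (ha.of_le (by exact_mod_cast le_top)) hsupp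
    hσ').trans ?_
  have h0 := C1Norm_nonneg a
  have h1 : 0 ≤ LpQ d p f :=
    Real.rpow_nonneg (integral_nonneg fun x => Real.rpow_nonneg (abs_nonneg _) _) _
  rw [← hK, ← Real.rpow_neg_one]
  gcongr
  · linarith
  · rw [le_div_iff₀ (by linarith)]
    linarith

end
end

section
/- Let d ≥ 2. There exists a constant C = C(d) such that for every t ∈ [1/12, 1] and every x ∈ ℝ^d, ∫₀ᵗ ∫_Q p(s, x−y) dy ds ≤ C · t · ∫_Q p(t, x−y) dy. -/
open MeasureTheory Real Set
open scoped ENNReal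

noncomputable section

/-- The heat kernel `p(t,x) = (4πt)^{-d/2} exp(-|x|²/(4t))` on `ℝ^d`. -/
noncomputable def heatKernel (d : ℕ) (t : ℝ) (x : Rd d) : ℝ :=
  (4 * π * t) ^ (-(d : ℝ) / 2) * Real.exp (-‖x‖ ^ 2 / (4 * t))

/-- `∫_Q p(t, x - y) dy`. -/
noncomputable def cubeHeat (d : ℕ) (t : ℝ) (x : Rd d) : ℝ :=
  ∫ y in unitCube d, heatKernel d t (x - y)

/-- The one-dimensional heat kernel. -/
def lineKernel (t w : ℝ) : ℝ := (√(4 * π * t))⁻¹ * Real.exp (-w ^ 2 / (4 * t))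

/-- The heat content of the unit interval seen from `u`. -/
def intervalHeat (t u : ℝ) : ℝ := ∫ v in Icc (-(1 / 2) : ℝ) (1 / 2), lineKernel t (u - v)

lemma lineKernel_nonneg (t w : ℝ) : 0 ≤ lineKernel t w := by
  unfold lineKernel; positivity

lemma continuous_lineKernel (t : ℝ) : Continuous (lineKernel t) := by
  unfold lineKernel; fun_prop

lemma intervalHeat_nonneg (t u : ℝ) : 0 ≤ intervalHeat t u :=
  integral_nonneg fun _ => lineKernel_nonneg _ _

lemma heatKernel_eq_prod (d : ℕ) {t : ℝ} (ht : 0 < t) (x : Rd d) :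
    heatKernel d t x = ∏ i, lineKernel t (x i) := by
  have hpos : 0 < 4 * π * t := by positivity
  unfold heatKernel lineKernel
  rw [Finset.prod_mul_distrib, ← Real.exp_sum, Finset.prod_const, Finset.card_univ,
    Fintype.card_fin, EuclideanSpace.real_norm_sq_eq, ← Finset.sum_div, Finset.sum_neg_distrib]
  congr 1
  rw [Real.sqrt_eq_rpow, ← Real.rpow_neg hpos.le, ← Real.rpow_natCast, ← Real.rpow_mul hpos.le]
  congr 1
  ring

lemma measurableSet_unitCube (d : ℕ) : MeasurableSet (unitCube d) := by
  have : unitCube d = ⋂ i, {x : Rd d | |x i| ≤ 1 / 2} := by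
    ext; simp [unitCube]
  rw [this]
  refine MeasurableSet.iInter fun i => (isClosed_le ?_ continuous_const).measurableSet
  fun_prop

lemma cubeHeat_eq_prod (d : ℕ) {t : ℝ} (ht : 0 < t) (x : Rd d) :
    cubeHeat d t x = ∏ i, intervalHeat t (x i) := by
  set φ : Fin d → ℝ → ℝ := fun i =>
    (Icc (-(1 / 2) : ℝ) (1 / 2)).indicator fun v => lineKernel t (x i - v) with hφ
  have hind : (unitCube d).indicator (fun y => heatKernel d t (x - y)) =
      fun y : Rd d => ∏ i, φ i (y i) := by
    ext y
    by_cases hy : y ∈ unitCube d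
    · rw [indicator_of_mem hy, heatKernel_eq_prod d ht]
      refine Finset.prod_congr rfl fun i _ => ?_
      have hi : y i ∈ Icc (-(1 / 2) : ℝ) (1 / 2) := abs_le.mp (hy i)
      rw [hφ]
      simp only
      rw [indicator_of_mem hi]
      rfl
    · rw [indicator_of_notMem hy]
      have : ∃ i, ¬ |y i| ≤ 1 / 2 := by simpa [unitCube] using hy
      obtain ⟨i, hi⟩ := this
      have hni : y i ∉ Icc (-(1 / 2) : ℝ) (1 / 2) := fun h => hi (abs_le.mpr h)
      refine (Finset.prod_eq_zero (Finset.mem_univ i) ?_).symm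
      exact indicator_of_notMem hni _
  rw [cubeHeat, ← integral_indicator (measurableSet_unitCube d), hind]
  have hmp := EuclideanSpace.volume_preserving_symm_measurableEquiv_toLp (Fin d)
  have := hmp.integral_comp (MeasurableEquiv.measurableEmbedding _)
    (fun y : Fin d → ℝ => ∏ i, φ i (y i))
  refine this.trans ?_
  rw [integral_fintype_prod_volume_eq_prod]
  refine Finset.prod_congr rfl fun i _ => ?_
  exact integral_indicator measurableSet_Icc

lemma integrableOn_lineKernel (t u : ℝ) :
    IntegrableOn (fun v => lineKernel t (u - v)) (Icc (-(1 / 2) : ℝ) (1 / 2)) := by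
  refine Continuous.integrableOn_Icc ?_
  exact (continuous_lineKernel t).comp (by fun_prop)

lemma intervalHeat_le_one {s : ℝ} (hs : 0 < s) (u : ℝ) : intervalHeat s u ≤ 1 := by
  have hb : 0 < 1 / (4 * s) := by positivity
  have heq : lineKernel s = fun w => (√(4 * π * s))⁻¹ * Real.exp (-(1 / (4 * s)) * w ^ 2) := by
    ext w
    unfold lineKernel
    congr 2
    ring
  have hint : Integrable (lineKernel s) := by
    rw [heq]
    exact (integrable_exp_neg_mul_sq hb).const_mul _
  have htot : ∫ w, lineKernel s w = 1 := by
    rw [heq, integral_const_mul, integral_gaussian]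
    have : π / (1 / (4 * s)) = 4 * π * s := by field_simp
    rw [this]
    exact inv_mul_cancel₀ (by positivity)
  calc intervalHeat s u ≤ ∫ v, lineKernel s (u - v) :=
        setIntegral_le_integral (hint.comp_sub_left u)
          (Filter.Eventually.of_forall fun _ => lineKernel_nonneg _ _)
    _ = 1 := by rw [integral_sub_left_eq_self (lineKernel s), htot]

lemma lineKernel_lower_bound {t w : ℝ} (ht : t ∈ Icc (1 / 12 : ℝ) 1) (hw : |w| ≤ 3 / 2) :
    (√(4 * π))⁻¹ * Real.exp (-7) ≤ lineKernel t w := by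
  obtain ⟨h1, h2⟩ := ht
  have ht0 : 0 < t := by linarith
  have hsqrt : √(4 * π * t) ≤ √(4 * π) :=
    Real.sqrt_le_sqrt (mul_le_of_le_one_right (by positivity) h2)
  unfold lineKernel
  gcongr ?_⁻¹ * Real.exp ?_
  rw [le_div_iff₀ (by positivity)]
  have : w ^ 2 ≤ (3 / 2) ^ 2 := by
    rw [← sq_abs]
    gcongr
  linarith

lemma intervalHeat_lower_bound {t u : ℝ} (ht : t ∈ Icc (1 / 12 : ℝ) 1) (hu : |u| ≤ 1) :
    (√(4 * π))⁻¹ * Real.exp (-7) ≤ intervalHeat t u := by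
  have hconst : ∫ _ in Icc (-(1 / 2) : ℝ) (1 / 2), (√(4 * π))⁻¹ * Real.exp (-7) =
      (√(4 * π))⁻¹ * Real.exp (-7) := by
    rw [setIntegral_const]
    norm_num
  rw [← hconst]
  refine setIntegral_mono_on (integrableOn_const (by simp)) (integrableOn_lineKernel t u)
    measurableSet_Icc fun v hv => lineKernel_lower_bound ht ?_
  have : |v| ≤ 1 / 2 := abs_le.mpr hv
  linarith [abs_sub u v]

lemma inv_sqrt_le_exp_inv {s : ℝ} (hs : 0 < s) : (√s)⁻¹ ≤ 17 * Real.exp (1 / (16 * s)) := by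
  have hz : 0 < s⁻¹ := inv_pos.mpr hs
  rw [← Real.sqrt_inv]
  have h1 : √s⁻¹ ≤ 1 + s⁻¹ := by
    rw [Real.sqrt_le_left (by positivity)]
    nlinarith
  have h2 : s⁻¹ / 16 + 1 ≤ Real.exp (1 / (16 * s)) := by
    have := Real.add_one_le_exp (1 / (16 * s))
    have he : 1 / (16 * s) = s⁻¹ / 16 := by field_simp
    linarith
  linarith

lemma lineKernel_le_of_half_le {s t w : ℝ} (hs : 0 < s) (hst : s ≤ t)
    (ht : t ∈ Icc (1 / 12 : ℝ) 1) (hw : 1 / 2 ≤ |w|) :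
    lineKernel s w ≤ 17 * Real.exp 1 * lineKernel t w := by
  obtain ⟨h1, h2⟩ := ht
  have ht0 : 0 < t := by linarith
  have hw2 : 1 / 4 ≤ w ^ 2 := by
    rw [← sq_abs]
    nlinarith
  have hinv : 1 / t ≤ 1 / s := one_div_le_one_div_of_le hs hst
  have htinv : 1 / t ≤ 12 := by
    rw [div_le_iff₀ ht0]
    linarith
  have hexp : Real.exp (1 / (16 * s)) * Real.exp (-w ^ 2 / (4 * s)) ≤
      Real.exp 1 * Real.exp (-w ^ 2 / (4 * t)) := by
    rw [← Real.exp_add, ← Real.exp_add, Real.exp_le_exp]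
    have e1 : 1 / (16 * s) + -w ^ 2 / (4 * s) = (1 / 16 - w ^ 2 / 4) * (1 / s) := by
      field_simp
      ring
    have e2 : -w ^ 2 / (4 * t) = -(w ^ 2 / 4) * (1 / t) := by
      field_simp
    rw [e1, e2]
    nlinarith
  have hsq : 1 ≤ (√t)⁻¹ := by
    rw [← Real.sqrt_inv, Real.one_le_sqrt]
    exact (one_le_inv₀ ht0).mpr h2
  unfold lineKernel
  rw [Real.sqrt_mul (by positivity) s, Real.sqrt_mul (by positivity) t, mul_inv, mul_inv]
  calc (√(4 * π))⁻¹ * (√s)⁻¹ * Real.exp (-w ^ 2 / (4 * s))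
      ≤ (√(4 * π))⁻¹ * (17 * Real.exp (1 / (16 * s))) * Real.exp (-w ^ 2 / (4 * s)) := by
        gcongr
        exact inv_sqrt_le_exp_inv hs
    _ = 17 * (√(4 * π))⁻¹ * (Real.exp (1 / (16 * s)) * Real.exp (-w ^ 2 / (4 * s))) := by ring
    _ ≤ 17 * (√(4 * π))⁻¹ * (Real.exp 1 * Real.exp (-w ^ 2 / (4 * t))) := by gcongr
    _ ≤ 17 * (√(4 * π))⁻¹ * (Real.exp 1 * Real.exp (-w ^ 2 / (4 * t))) * (√t)⁻¹ :=
        le_mul_of_one_le_right (by positivity) hsq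
    _ = _ := by ring

lemma exists_intervalHeat_le :
    ∃ K : ℝ, 0 < K ∧ ∀ t ∈ Icc (1 / 12 : ℝ) 1, ∀ s ∈ Ioc (0 : ℝ) t, ∀ u : ℝ,
      intervalHeat s u ≤ K * intervalHeat t u := by
  set c : ℝ := (√(4 * π))⁻¹ * Real.exp (-7) with hc
  have hc0 : 0 < c := by positivity
  refine ⟨max c⁻¹ (17 * Real.exp 1), lt_max_of_lt_left (by positivity), ?_⟩
  intro t ht s hs u
  rcases le_total |u| 1 with hu | hu
  · calc intervalHeat s u ≤ 1 := intervalHeat_le_one hs.1 u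
      _ = c⁻¹ * c := (inv_mul_cancel₀ hc0.ne').symm
      _ ≤ max c⁻¹ (17 * Real.exp 1) * intervalHeat t u :=
        mul_le_mul (le_max_left _ _) (intervalHeat_lower_bound ht hu) hc0.le
          (le_max_of_le_left (by positivity))
  · refine le_trans ?_ (mul_le_mul_of_nonneg_right (le_max_right _ _) (intervalHeat_nonneg t u))
    unfold intervalHeat
    rw [← integral_const_mul]
    refine setIntegral_mono_on (integrableOn_lineKernel s u)
      ((integrableOn_lineKernel t u).const_mul _) measurableSet_Icc fun v hv =>
        lineKernel_le_of_half_le hs.1 hs.2 ht ?_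
    have : |v| ≤ 1 / 2 := abs_le.mpr hv
    linarith [abs_sub_abs_le_abs_sub u v]

/-- For `d ≥ 2` there is a constant `C = C(d)` such that for every
`t ∈ [1/12, 1]` and every `x ∈ ℝ^d`,
`∫₀ᵗ ∫_Q p(s, x-y) dy ds ≤ C · t · ∫_Q p(t, x-y) dy`. -/
theorem stmt_5 (d : ℕ) (hd : 2 ≤ d) :
    ∃ C : ℝ, 0 < C ∧ ∀ t ∈ Icc (1/12 : ℝ) 1, ∀ x : Rd d,
      (∫ s in Ioc (0:ℝ) t, cubeHeat d s x) ≤ C * t * cubeHeat d t x := by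
  obtain ⟨K, hK, hle⟩ := exists_intervalHeat_le
  refine ⟨K ^ d, by positivity, fun t ht x => ?_⟩
  have ht0 : 0 < t := by linarith [ht.1]
  have hpt : ∀ s ∈ Ioc (0 : ℝ) t, cubeHeat d s x ≤ K ^ d * cubeHeat d t x := by
    intro s hs
    have hpow : K ^ d = ∏ _i : Fin d, K := by simp
    rw [cubeHeat_eq_prod d hs.1, cubeHeat_eq_prod d ht0, hpow, ← Finset.prod_mul_distrib]
    exact Finset.prod_le_prod (fun i _ => intervalHeat_nonneg _ _) fun i _ => hle t ht s hs _
  calc ∫ s in Ioc (0 : ℝ) t, cubeHeat d s x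
      ≤ ∫ _ in Ioc (0 : ℝ) t, K ^ d * cubeHeat d t x := by
        refine integral_mono_of_nonneg ?_ (integrableOn_const (by simp)) ?_
        · filter_upwards [ae_restrict_mem measurableSet_Ioc] with s hs
          rw [cubeHeat_eq_prod d hs.1]
          exact Finset.prod_nonneg fun i _ => intervalHeat_nonneg _ _
        · filter_upwards [ae_restrict_mem measurableSet_Ioc] with s hs
          exact hpt s hs
    _ = K ^ d * t * cubeHeat d t x := by
        rw [setIntegral_const]
        simp [ht0.le]
        ring

end
end
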